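/- Let F = F(x^1,…,x^N) satisfy the commutativity equations F_i F_j = F_j F_i for all i,j, suppose the matrix P = (F_{i₀ i j}) (rows i ≠ i₀) has rank N−1, and suppose h := Σ_k A^k F_{kii} is non-zero (this scalar is independent of the choice of i ∈ {1,…,N}), where A^k = (−1)^{k+1} det P_k. Then the vector field e = Σ_k e^k ∂_{x^k} with e^k = h^{-1} A^k is the identity vector field of the multiplication ∂_u ∗ ∂_v = Σ u^i v^j F_{ijk} ∂_{x^k}; equivalently, Σ_k e^k F_{kij} = δ_{ij} for all i,j. -/

import Mathlib

open scoped BigOperators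

noncomputable def pd {N : ℕ} (i : Fin N) (f : (Fin N → ℂ) → ℂ) : (Fin N → ℂ) → ℂ :=
  fun x => fderiv ℂ f x (Pi.single i 1)

noncomputable def D3 {N : ℕ} (F : (Fin N → ℂ) → ℂ) (i p q : Fin N) (x : Fin N → ℂ) : ℂ :=
  pd i (pd p (pd q F)) x

noncomputable def Fmat {N : ℕ} (F : (Fin N → ℂ) → ℂ) (i : Fin N) (x : Fin N → ℂ) :
    Matrix (Fin N) (Fin N) ℂ :=
  Matrix.of fun p q => D3 F i p q x

/-- The `(N−1)×N` matrix `P = (F_{i₀ i j})` with rows indexed by `i ≠ i₀`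
(in increasing order) and columns by `j = 1,…,N`. -/
noncomputable def Pmat {n : ℕ} (F : (Fin (n + 1) → ℂ) → ℂ) (i₀ : Fin (n + 1))
    (x : Fin (n + 1) → ℂ) : Matrix (Fin n) (Fin (n + 1)) ℂ :=
  Matrix.of fun i j => D3 F i₀ (i₀.succAbove i) j x

/-- `A^k = (−1)^{k+1} det P_k` (with the 1-based sign convention of the paper,
so `(−1)^{k}` for the 0-based index `k`), where `P_k` is `P` with the `k`-th
column removed. -/
noncomputable def Acoef {n : ℕ} (F : (Fin (n + 1) → ℂ) → ℂ) (i₀ : Fin (n + 1))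
    (x : Fin (n + 1) → ℂ) (k : Fin (n + 1)) : ℂ :=
  (-1 : ℂ) ^ (k : ℕ) *
    (Matrix.of fun i j : Fin n => Pmat F i₀ x i (k.succAbove j)).det

/-- The matrix `B` with entries `B_{ij} = Σ_k A^k F_{kij}`. -/
noncomputable def Bmat {n : ℕ} (F : (Fin (n + 1) → ℂ) → ℂ) (i₀ : Fin (n + 1))
    (x : Fin (n + 1) → ℂ) : Matrix (Fin (n + 1)) (Fin (n + 1)) ℂ :=
  Matrix.of fun i j => ∑ k, Acoef F i₀ x k * D3 F k i j x

theorem contDiff_pd {N : ℕ} {f : (Fin N → ℂ) → ℂ} (hf : ContDiff ℂ ⊤ f) (i : Fin N) :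
    ContDiff ℂ ⊤ (pd i f) :=
  (hf.fderiv_right (m := ⊤) le_top).clm_apply contDiff_const

theorem pd_comm {N : ℕ} {f : (Fin N → ℂ) → ℂ} (hf : ContDiff ℂ ⊤ f) (i j : Fin N) :
    pd i (pd j f) = pd j (pd i f) := by
  have pd_pd_apply (a b : Fin N) (x : Fin N → ℂ) :
      pd a (pd b f) x = fderiv ℂ (fderiv ℂ f) x (Pi.single a 1) (Pi.single b 1) := by
    have hd : DifferentiableAt ℂ (fderiv ℂ f) x :=
      (hf.fderiv_right (m := ⊤) le_top).differentiable (by simp) x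
    change fderiv ℂ (fun y => fderiv ℂ f y (Pi.single b 1)) x (Pi.single a 1) = _
    rw [fderiv_clm_apply hd (differentiableAt_const _)]
    simp
  funext x
  rw [pd_pd_apply, pd_pd_apply]
  exact (hf.contDiffAt.isSymmSndFDerivAt le_top) _ _

theorem D3_swap_left {N : ℕ} {F : (Fin N → ℂ) → ℂ} (hF : ContDiff ℂ ⊤ F) (i j k : Fin N)
    (x : Fin N → ℂ) : D3 F i j k x = D3 F j i k x :=
  congrFun (pd_comm (contDiff_pd hF k) i j) x

theorem D3_swap_right {N : ℕ} {F : (Fin N → ℂ) → ℂ} (hF : ContDiff ℂ ⊤ F) (i j k : Fin N)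
    (x : Fin N → ℂ) : D3 F i j k x = D3 F i k j x := by
  unfold D3
  rw [pd_comm hF j k]

theorem Acoef_eq_adjugate {n : ℕ} (F : (Fin (n + 1) → ℂ) → ℂ) (i₀ : Fin (n + 1))
    (x : Fin (n + 1) → ℂ) (k : Fin (n + 1)) :
    Acoef F i₀ x k = (-1) ^ (i₀ : ℕ) * (Fmat F i₀ x).adjugate k i₀ := by
  rw [Matrix.adjugate_fin_succ_eq_det_submatrix, ← mul_assoc, pow_add, ← mul_assoc,
    ← mul_pow, neg_one_mul, neg_neg, one_pow, one_mul]
  rfl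

theorem sum_Fmat_mul_Acoef {n : ℕ} (F : (Fin (n + 1) → ℂ) → ℂ) (i₀ : Fin (n + 1))
    (x : Fin (n + 1) → ℂ) (i : Fin (n + 1)) :
    ∑ k, Fmat F i₀ x i k * Acoef F i₀ x k =
      if i = i₀ then (-1) ^ (i₀ : ℕ) * (Fmat F i₀ x).det else 0 := by
  have hadj := congrFun (congrFun (Fmat F i₀ x).mul_adjugate i) i₀
  rw [Matrix.mul_apply, Matrix.smul_apply, Matrix.one_apply] at hadj
  simp_rw [Acoef_eq_adjugate, mul_left_comm _ ((-1 : ℂ) ^ (i₀ : ℕ)), ← Finset.mul_sum, hadj]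
  split_ifs <;> simp

theorem Bmat_eq_sum_smul {n : ℕ} (F : (Fin (n + 1) → ℂ) → ℂ) (i₀ : Fin (n + 1))
    (x : Fin (n + 1) → ℂ) : Bmat F i₀ x = ∑ k, Acoef F i₀ x k • Fmat F k x := by
  ext i j
  simp [Bmat, Fmat, Matrix.sum_apply]

theorem Bmat_apply_right {n : ℕ} {F : (Fin (n + 1) → ℂ) → ℂ} (hF : ContDiff ℂ ⊤ F)
    (i₀ : Fin (n + 1)) (x : Fin (n + 1) → ℂ) (i : Fin (n + 1)) :
    Bmat F i₀ x i i₀ = if i = i₀ then (-1) ^ (i₀ : ℕ) * (Fmat F i₀ x).det else 0 := by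
  rw [← sum_Fmat_mul_Acoef]
  change ∑ k, Acoef F i₀ x k * D3 F k i i₀ x = _
  refine Finset.sum_congr rfl fun k _ => ?_
  rw [mul_comm, D3_swap_right hF k i i₀, D3_swap_left hF k i₀ i, D3_swap_right hF i₀ k i]
  rfl

/-- The matrix `B` is scalar as soon as `F_{i₀}` is invertible: `B` commutes with every `F_j` and
has `∂_{i₀}` as an eigenvector, while the vectors `F_j ∂_{i₀} = F_{i₀} ∂_j` span. -/
theorem Bmat_eq_smul_one {n : ℕ} {F : (Fin (n + 1) → ℂ) → ℂ} (hF : ContDiff ℂ ⊤ F)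
    (i₀ : Fin (n + 1)) (x : Fin (n + 1) → ℂ)
    (hcomm : ∀ i j : Fin (n + 1), Fmat F i x * Fmat F j x = Fmat F j x * Fmat F i x)
    (hdet : (Fmat F i₀ x).det ≠ 0) :
    Bmat F i₀ x = ((-1) ^ (i₀ : ℕ) * (Fmat F i₀ x).det) • 1 := by
  have hB (j : Fin (n + 1)) : Bmat F i₀ x * Fmat F j x = Fmat F j x * Bmat F i₀ x := by
    simp_rw [Bmat_eq_sum_smul, Finset.sum_mul, Finset.mul_sum, Matrix.smul_mul, Matrix.mul_smul,
      hcomm _ j]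
  have hcol (p j : Fin (n + 1)) : Fmat F i₀ x p j = Fmat F j x p i₀ := by
    change D3 F i₀ p j x = D3 F j p i₀ x
    rw [D3_swap_right hF i₀ p j, D3_swap_left hF i₀ j p, D3_swap_right hF j i₀ p]
  refine ((Matrix.isUnit_iff_isUnit_det _).2 hdet.isUnit).mul_right_cancel ?_
  ext i j
  have hij := congrFun (congrFun (hB j) i) i₀
  rw [Matrix.mul_apply, Matrix.mul_apply] at hij
  rw [Matrix.mul_apply, Matrix.smul_mul, one_mul, Matrix.smul_apply]
  simp_rw [hcol, hij, Bmat_apply_right hF]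
  simp [mul_comm]

/-- the vector field `e^k = h⁻¹ A^k`, with
`h = Σ_k A^k F_{kii}` (any `i`, here `i = i₀`), is the identity field:
`Σ_k e^k F_{kij} = δ_{ij}`. -/
theorem stmt17 {n : ℕ} (F : (Fin (n + 1) → ℂ) → ℂ) (hF : ContDiff ℂ ⊤ F)
    (hcomm : ∀ x, ∀ i j : Fin (n + 1), Fmat F i x * Fmat F j x = Fmat F j x * Fmat F i x)
    (i₀ : Fin (n + 1)) (x : Fin (n + 1) → ℂ)
    (hrank : (Pmat F i₀ x).rank = n)
    (h : ℂ) (hh : h = ∑ k, Acoef F i₀ x k * D3 F k i₀ i₀ x) (hh0 : h ≠ 0) :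
    ∀ i j : Fin (n + 1),
      ∑ k, (h⁻¹ * Acoef F i₀ x k) * D3 F k i j x = if i = j then 1 else 0 := by
  have hhB : h = Bmat F i₀ x i₀ i₀ := hh
  rw [Bmat_apply_right hF, if_pos rfl] at hhB
  have hdet : (Fmat F i₀ x).det ≠ 0 := right_ne_zero_of_mul (hhB ▸ hh0)
  have hB := Bmat_eq_smul_one hF i₀ x (hcomm x) hdet
  intro i j
  have hij : ∑ k, Acoef F i₀ x k * D3 F k i j x = h * if i = j then 1 else 0 := by
    change Bmat F i₀ x i j = _
    rw [hB, ← hhB, Matrix.smul_apply, Matrix.one_apply, smul_eq_mul]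
  simp_rw [mul_assoc, ← Finset.mul_sum, hij]
  exact inv_mul_cancel_left₀ hh0 _
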